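/- Let G be a 2-connected subcubic graph, C₀ a cycle of G, and x a vertex of G. Then G has a finite cactus subgraph F containing C₀ and x such that for every component H of G − F, there is a cycle C of F other than C₀ such that the subgraph of G induced by V(H) ∪ V(C) is 2-connected. -/

import Mathlib

namespace IGraph

open SimpleGraph

universe u w

variable {V : Type u} {W : Type w}

/-- `G` is locally finite: every vertex has finite degree. -/
def LocFin (G : SimpleGraph V) : Prop := ∀ v : V, (G.neighborSet v).Finite

/-- A ray of `G`: a one-way infinite path, given by an injective sequence of
successively adjacent vertices. -/
def IsRay (G : SimpleGraph V) (R : ℕ → V) : Prop :=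
  Function.Injective R ∧ ∀ n : ℕ, G.Adj (R n) (R (n + 1))

/-- `G − S`, kept on the same vertex type (removed vertices become isolated). -/
def del (G : SimpleGraph V) (S : Set V) : SimpleGraph V where
  Adj a b := G.Adj a b ∧ a ∉ S ∧ b ∉ S
  symm := ⟨fun a b h => ⟨h.1.symm, h.2.2, h.2.1⟩⟩
  loopless := ⟨fun a h => G.loopless.irrefl a h.1⟩

/-- Two rays are equivalent in `G` if for every finite `S ⊆ V(G)` some component of
`G − S` contains a tail of both. -/
def RayEquiv (G : SimpleGraph V) (R₁ R₂ : ℕ → V) : Prop :=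
  ∀ S : Set V, S.Finite →
    ∃ m n : ℕ, (∀ i, m ≤ i → R₁ i ∉ S) ∧ (∀ j, n ≤ j → R₂ j ∉ S) ∧
      (del G S).Reachable (R₁ m) (R₂ n)

/-- `F` is a faithful subgraph of `G` (both presented on the same vertex type):
(1) every end of `G` contains a ray of `F`, and (2) two rays of `F` are equivalent in `F`
iff they are equivalent in `G`. -/
def Faithful (F G : SimpleGraph V) : Prop :=
  (∀ R : ℕ → V, IsRay G R → ∃ R' : ℕ → V, IsRay F R' ∧ RayEquiv G R R') ∧
  ∀ R₁ R₂ : ℕ → V, IsRay F R₁ → IsRay F R₂ → (RayEquiv F R₁ R₂ ↔ RayEquiv G R₁ R₂)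

/-- `N_G(X)`: vertices outside `X` with a neighbor in `X`. -/
def NSet (G : SimpleGraph V) (X : Set V) : Set V := {y | y ∉ X ∧ ∃ x ∈ X, G.Adj x y}

/-- `Z_G(X)`: vertices of `X` with a neighbor outside `X`. -/
def ZSet (G : SimpleGraph V) (X : Set V) : Set V := {x | x ∈ X ∧ ∃ y, y ∉ X ∧ G.Adj x y}

/-- The vertex set of the component of `G − S` containing `v`. -/
def compOf (G : SimpleGraph V) (S : Set V) (v : V) : Set V := {x | (del G S).Reachable v x}

/-- The degree of the end of `G` represented by the ray `R`: the supremum of the numbers of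
pairwise vertex-disjoint rays equivalent to `R`. -/
noncomputable def endDegree (G : SimpleGraph V) (R : ℕ → V) : ℕ∞ :=
  ⨆ n ∈ {n : ℕ | ∃ f : Fin n → ℕ → V,
      (∀ i, IsRay G (f i) ∧ RayEquiv G (f i) R) ∧
      ∀ i j, i ≠ j → Disjoint (Set.range (f i)) (Set.range (f j))}, (n : ℕ∞)

/-- `H` is `k`-connected: `|V(H)| > k` and removing fewer than `k` vertices leaves a
connected graph. -/
def IsKConn (k : ℕ) (H : SimpleGraph W) : Prop :=
  (k : Cardinal) < Cardinal.mk W ∧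
    ∀ X : Set W, X.Finite → X.ncard < k → (H.induce Xᶜ).Connected

/-- Every vertex has degree at most 3. -/
def Subcubic (G : SimpleGraph V) : Prop :=
  ∀ v : V, (G.neighborSet v).Finite ∧ (G.neighborSet v).ncard ≤ 3

/-- Every vertex has degree exactly 3. -/
def Cubic (G : SimpleGraph V) : Prop := ∀ v : V, (G.neighborSet v).ncard = 3

/-- `S` is 3-connected in `G`: every two vertices of `S` are joined by three pairwise
internally disjoint paths of `G`. -/
def ThreeConnIn (G : SimpleGraph V) (S : Set V) : Prop :=
  ∀ u v : V, u ∈ S → v ∈ S → u ≠ v →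
    ∃ p₁ p₂ p₃ : G.Path u v,
      p₁ ≠ p₂ ∧ p₁ ≠ p₃ ∧ p₂ ≠ p₃ ∧
      (∀ x, x ∈ (p₁ : G.Walk u v).support → x ∈ (p₂ : G.Walk u v).support → x = u ∨ x = v) ∧
      (∀ x, x ∈ (p₁ : G.Walk u v).support → x ∈ (p₃ : G.Walk u v).support → x = u ∨ x = v) ∧
      (∀ x, x ∈ (p₂ : G.Walk u v).support → x ∈ (p₃ : G.Walk u v).support → x = u ∨ x = v)

/-- A subgraph which is a (finite) cycle: finite, nonempty, connected and 2-regular. -/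
def IsCycleSub {G : SimpleGraph W} (C : G.Subgraph) : Prop :=
  C.verts.Finite ∧ C.verts.Nonempty ∧ C.Connected ∧
    ∀ v ∈ C.verts, (C.neighborSet v).ncard = 2

/-- A cactus: a connected subcubic graph whose cycles are pairwise vertex-disjoint and whose
edges decompose into vertex-disjoint cycles and vertex-disjoint paths (equivalently, every
vertex on no cycle has degree at most 2). -/
def IsCactus (H : SimpleGraph W) : Prop :=
  H.Connected ∧ Subcubic H ∧
  (∀ C₁ C₂ : H.Subgraph, IsCycleSub C₁ → IsCycleSub C₂ → C₁ ≠ C₂ →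
    Disjoint C₁.verts C₂.verts) ∧
  ∀ v : W, (∀ C : H.Subgraph, IsCycleSub C → v ∉ C.verts) → (H.neighborSet v).ncard ≤ 2

/-- A semi-cactus: connected, maximum degree at most 4, every block is a cycle or a `K₂`
(equivalently, distinct cycles are edge-disjoint), and every vertex lies in at most two
blocks (cycles through `v` together with bridges at `v` number at most 2). -/
def IsSemiCactus (H : SimpleGraph W) : Prop :=
  H.Connected ∧ (∀ v : W, (H.neighborSet v).Finite ∧ (H.neighborSet v).ncard ≤ 4) ∧
  (∀ C₁ C₂ : H.Subgraph, IsCycleSub C₁ → IsCycleSub C₂ → C₁ ≠ C₂ →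
    Disjoint C₁.edgeSet C₂.edgeSet) ∧
  ∀ v : W,
    {C : H.Subgraph | IsCycleSub C ∧ v ∈ C.verts}.encard +
      {e : Sym2 W | e ∈ H.edgeSet ∧ v ∈ e ∧
        ∀ C : H.Subgraph, IsCycleSub C → e ∉ C.edgeSet}.encard ≤ 2

/-- Every cycle of `H` is even. -/
def EvenCycles (H : SimpleGraph W) : Prop :=
  ∀ C : H.Subgraph, IsCycleSub C → Even C.verts.ncard

/-- `v` is a cut-vertex of `H`: removing `v` separates two vertices. -/
def IsCutVert (H : SimpleGraph W) (v : W) : Prop :=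
  ∃ a b : W, a ≠ v ∧ b ≠ v ∧ H.Reachable a b ∧ ¬ (del H {v}).Reachable a b

/-- `H` is non-separable: connected without cut-vertices. -/
def Nonseparable (H : SimpleGraph W) : Prop := H.Connected ∧ ∀ v : W, ¬ IsCutVert H v

/-- `B` is the vertex set of a block of `H`: a maximal set inducing a non-separable graph. -/
def IsBlockSet (H : SimpleGraph W) (B : Set W) : Prop :=
  Nonseparable (H.induce B) ∧ ∀ B' : Set W, B ⊆ B' → Nonseparable (H.induce B') → B' = B

/-- An end-block: a block containing at most one cut-vertex of `H`. -/
def IsEndBlock (H : SimpleGraph W) (B : Set W) : Prop :=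
  IsBlockSet H B ∧ {v ∈ B | IsCutVert H v}.encard ≤ 1

/-- A block-chain: a connected graph whose block-cut tree is a path, i.e. every block
contains at most two cut-vertices and every cut-vertex lies in at most two blocks. -/
def IsBlockChain (H : SimpleGraph W) : Prop :=
  H.Connected ∧
  (∀ B : Set W, IsBlockSet H B → {v ∈ B | IsCutVert H v}.encard ≤ 2) ∧
  ∀ v : W, IsCutVert H v → {B : Set W | IsBlockSet H B ∧ v ∈ B}.encard ≤ 2

/-- A block-chain connecting `u` and `v`: either `H` is non-separable, or `H` is separable
and `u`, `v` are non-cut vertices of two distinct end-blocks. -/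
def BlockChainConn (H : SimpleGraph W) (u v : W) : Prop :=
  IsBlockChain H ∧
  (Nonseparable H ∨
    ((∃ x, IsCutVert H x) ∧
      ∃ B₁ B₂ : Set W, IsEndBlock H B₁ ∧ IsEndBlock H B₂ ∧ B₁ ≠ B₂ ∧
        u ∈ B₁ ∧ v ∈ B₂ ∧ ¬ IsCutVert H u ∧ ¬ IsCutVert H v))

/-- The `k`-th power of `G`: vertices at distance at most `k` become adjacent. -/
def gpow (G : SimpleGraph V) (k : ℕ) : SimpleGraph V where
  Adj u v := u ≠ v ∧ ∃ p : G.Walk u v, p.length ≤ k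
  symm := ⟨fun u v h => ⟨h.1.symm, by obtain ⟨p, hp⟩ := h.2; exact ⟨p.reverse, by simpa using hp⟩⟩⟩
  loopless := ⟨fun v h => h.1 rfl⟩

/-- The copy `G × {d₀}` of `G` inside the Cartesian product `G □ D`. -/
def copyAt (G : SimpleGraph V) (d₀ : W) : SimpleGraph (V × W) where
  Adj p q := G.Adj p.1 q.1 ∧ p.2 = d₀ ∧ q.2 = d₀
  symm := ⟨fun p q h => ⟨h.1.symm, h.2.2, h.2.1⟩⟩
  loopless := ⟨fun p h => G.loopless.irrefl _ h.1⟩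

/-- The line graph of the subgraph `F` of `G`, presented on the vertex set `E(G)` of the
line graph of `G` (edges of `G` not in `F` are isolated). -/
def lineSub (G F : SimpleGraph V) : SimpleGraph G.edgeSet where
  Adj e f := (e : Sym2 V) ∈ F.edgeSet ∧ (f : Sym2 V) ∈ F.edgeSet ∧ e ≠ f ∧
    ∃ x : V, x ∈ (e : Sym2 V) ∧ x ∈ (f : Sym2 V)
  symm := ⟨fun e f h =>
    ⟨h.2.1, h.1, h.2.2.1.symm, by obtain ⟨x, h1, h2⟩ := h.2.2.2; exact ⟨x, h2, h1⟩⟩⟩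
  loopless := ⟨fun e h => h.2.2.1 rfl⟩

/-- `B ⊆ V(G)` induces a cycle of `G`. -/
def IsCycleSet (G : SimpleGraph V) (B : Set V) : Prop :=
  B.Finite ∧ B.Nonempty ∧ (G.induce B).Connected ∧
    ∀ v ∈ B, (G.neighborSet v ∩ B).ncard = 2

/-- The graph on `V` formed by the edges of `G` with both ends in `S`. -/
def inside (G : SimpleGraph V) (S : Set V) : SimpleGraph V where
  Adj a b := G.Adj a b ∧ a ∈ S ∧ b ∈ S
  symm := ⟨fun _ _ h => ⟨h.1.symm, h.2.2, h.2.1⟩⟩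
  loopless := ⟨fun a h => G.loopless.irrefl a h.1⟩

lemma inside_le (G : SimpleGraph V) (S : Set V) : inside G S ≤ G := fun _ _ h => h.1

/-- A predicate preserved along edges is preserved along reachability. -/
lemma prop_of_reachable {H : SimpleGraph V} {P : V → Prop}
    (step : ∀ x y, H.Adj x y → P x → P y) {a b : V} (h : H.Reachable a b) (ha : P a) : P b := by
  obtain ⟨p⟩ := h
  induction p with
  | nil => exact ha
  | cons hadj _ ih => exact ih (step _ _ hadj ha)

/-- A map sending adjacent vertices to mutually reachable ones preserves reachability. -/
lemma reachable_map_of_adj {H : SimpleGraph V} {H' : SimpleGraph W} (f : V → W)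
    (step : ∀ x y, H.Adj x y → H'.Reachable (f x) (f y)) {a b : V} (h : H.Reachable a b) :
    H'.Reachable (f a) (f b) :=
  prop_of_reachable (P := fun y => H'.Reachable (f a) (f y))
    (fun x y hxy hx => hx.trans (step x y hxy)) h (Reachable.refl _)

lemma mem_of_reachable_inside {G : SimpleGraph V} {S : Set V} {a b : V}
    (h : (inside G S).Reachable a b) (ha : a ∈ S) : b ∈ S :=
  prop_of_reachable (P := (· ∈ S)) (fun _ _ (hxy : (inside G S).Adj _ _) _ => hxy.2.2) h ha

lemma subgraph_connected_iff {G : SimpleGraph V} {C : G.Subgraph} :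
    C.Connected ↔ C.verts.Nonempty ∧
      ∀ u ∈ C.verts, ∀ v ∈ C.verts, C.spanningCoe.Reachable u v := by
  constructor
  · refine fun h => ⟨h.nonempty, fun u hu v hv => ?_⟩
    exact reachable_map_of_adj (H := C.coe) (fun z => (z : V)) (fun x y hxy => Adj.reachable hxy)
      (h.coe.preconnected ⟨u, hu⟩ ⟨v, hv⟩)
  · rintro ⟨⟨z, hz⟩, h⟩
    rw [Subgraph.connected_iff']
    have : Nonempty C.verts := ⟨⟨z, hz⟩⟩
    refine ⟨fun u v => ?_⟩
    obtain ⟨_, h'⟩ := prop_of_reachable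
      (P := fun y => ∃ hy : y ∈ C.verts, C.coe.Reachable u ⟨y, hy⟩)
      (fun x y hxy ⟨hx, hr⟩ => ⟨C.edge_vert hxy.symm, hr.trans (Adj.reachable hxy)⟩)
      (h u u.2 v v.2) ⟨u.2, Reachable.refl _⟩
    exact h'

lemma ncard_neighborSet_coe {G : SimpleGraph V} (F : G.Subgraph) (v : F.verts) :
    (F.coe.neighborSet v).ncard = (F.neighborSet v).ncard := by
  rw [← Set.ncard_image_of_injective _ Subtype.val_injective]
  congr 1
  ext y
  simp only [Set.mem_image, mem_neighborSet, Subgraph.coe_adj, Subtype.exists, exists_and_right,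
    exists_eq_right, Subgraph.mem_neighborSet]
  exact ⟨fun ⟨_, h⟩ => h, fun h => ⟨F.edge_vert h.symm, h⟩⟩

lemma IsCycleSub.coe_isCycles {G : SimpleGraph V} {C : G.Subgraph} (hC : IsCycleSub C) :
    C.coe.IsCycles := by
  intro v _
  rw [← hC.2.2.2 v v.2]
  exact ncard_neighborSet_coe C v

/-- A cycle stays connected after deleting an edge. -/
lemma IsCycleSub.reachable_deleteEdges {G : SimpleGraph V} {C : G.Subgraph} (hC : IsCycleSub C)
    (e : Sym2 V) {u v : V} (hu : u ∈ C.verts) (hv : v ∈ C.verts) :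
    (C.spanningCoe.deleteEdges {e}).Reachable u v := by
  have : Finite C.verts := hC.1
  refine reachable_map_of_adj id (fun x y hxy => ?_)
    ((subgraph_connected_iff.1 hC.2.2.1).2 u hu v hv)
  by_cases he : s(x, y) = e
  · subst he
    have hx : x ∈ C.verts := C.edge_vert hxy
    have hy : y ∈ C.verts := C.edge_vert hxy.symm
    have hadj : C.coe.Adj ⟨x, hx⟩ ⟨y, hy⟩ := hxy
    refine reachable_map_of_adj (fun z : C.verts => (z : V)) (fun a b hab => Adj.reachable ?_)
      (hC.coe_isCycles.reachable_deleteEdges hadj)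
    rw [deleteEdges_adj] at hab ⊢
    refine ⟨hab.1, fun h => hab.2 ?_⟩
    simpa [Subtype.ext_iff] using h
  · exact Adj.reachable (by rw [deleteEdges_adj]; exact ⟨hxy, he⟩)

lemma exists_not_reachable_deleteEdges {E : SimpleGraph V} {U : Set V} {u w : V}
    (hu : u ∈ U) (hw : w ∉ U) (hcl : ∀ x ∈ U, ∀ y, E.Adj x y → y ∈ U ∨ y = w)
    (hfin : (E.neighborSet w).Finite) (hone : (E.neighborSet w ∩ U).ncard ≤ 1) :
    ∃ e : Sym2 V, ¬ (E.deleteEdges {e}).Reachable u w := by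
  obtain ⟨z, hz⟩ : ∃ z, ∀ y ∈ E.neighborSet w ∩ U, y = z := by
    rcases Set.eq_empty_or_nonempty (E.neighborSet w ∩ U) with h | ⟨z, hz⟩
    · exact ⟨u, by simp [h]⟩
    · exact ⟨z, fun y hy => (Set.ncard_le_one (hfin.inter_of_left _)).1 hone y hy z hz⟩
  refine ⟨s(w, z), fun h => hw ?_⟩
  refine prop_of_reachable (P := (· ∈ U)) (fun x y hxy hx => ?_) h hu
  rw [deleteEdges_adj] at hxy
  rcases hcl x hx y hxy.1 with h | rfl
  · exact h
  · exact absurd (by rw [hz x ⟨hxy.1.symm, hx⟩, Sym2.eq_swap]; rfl) hxy.2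

/-- In a graph of maximum degree at most three, connectedness after deleting any edge gives
connectedness after deleting any vertex. -/
lemma reachable_del_of_reachable_deleteEdges {E : SimpleGraph V} {S : Set V}
    (hdeg : ∀ v, (E.neighborSet v).Finite ∧ (E.neighborSet v).ncard ≤ 3)
    (hedge : ∀ e, ∀ u ∈ S, ∀ v ∈ S, (E.deleteEdges {e}).Reachable u v)
    {w u v : V} (hw : w ∈ S) (hu : u ∈ S) (hv : v ∈ S) (huw : u ≠ w) (hvw : v ≠ w) :
    (del E {w}).Reachable u v := by
  by_contra hcon
  have key : ∀ z ∈ S, z ≠ w →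
      1 < (E.neighborSet w ∩ {y | (del E {w}).Reachable z y}).ncard := by
    intro z hz hzw
    by_contra! hone
    have hnw : ∀ y, (del E {w}).Reachable z y → y ≠ w := fun y hy =>
      prop_of_reachable (P := (· ≠ w)) (fun _ _ (h : (del E {w}).Adj _ _) _ => h.2.2) hy hzw
    obtain ⟨e, he⟩ := exists_not_reachable_deleteEdges (E := E) (u := z) (w := w)
      (U := {y | (del E {w}).Reachable z y}) (Reachable.refl _) (fun h => hnw _ h rfl)
      (fun x hx y hxy => or_iff_not_imp_right.2 fun hyw =>
        Reachable.trans hx (Adj.reachable ⟨hxy, hnw x hx, hyw⟩)) (hdeg w).1 hone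
    exact he (hedge e z hz w hw)
  have h1 := key u hu huw
  have h2 := key v hv hvw
  have hd : Disjoint (E.neighborSet w ∩ {y | (del E {w}).Reachable u y})
      (E.neighborSet w ∩ {y | (del E {w}).Reachable v y}) :=
    Set.disjoint_left.2 fun y hy hy' => hcon (Reachable.trans hy.2 (Reachable.symm hy'.2))
  have h3 := Set.ncard_union_eq hd ((hdeg w).1.inter_of_left _) ((hdeg w).1.inter_of_left _)
  have h4 := Set.ncard_le_ncard (Set.union_subset
    (Set.inter_subset_left (s := E.neighborSet w) (t := {y | (del E {w}).Reachable u y}))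
    (Set.inter_subset_left (s := E.neighborSet w) (t := {y | (del E {w}).Reachable v y})))
    (hdeg w).1
  have := (hdeg w).2
  omega

lemma IsCycleSub.reachable_del {G : SimpleGraph V} {C : G.Subgraph} (hC : IsCycleSub C)
    {w u v : V} (hu : u ∈ C.verts) (hv : v ∈ C.verts) (huw : u ≠ w) (hvw : v ≠ w) :
    (del C.spanningCoe {w}).Reachable u v := by
  by_cases hw : w ∈ C.verts
  · refine reachable_del_of_reachable_deleteEdges (S := C.verts) (fun v => ?_)
      (fun e u hu v hv => hC.reachable_deleteEdges e hu hv) hw hu hv huw hvw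
    have hsub : C.spanningCoe.neighborSet v ⊆ C.verts :=
      fun y (hy : C.Adj v y) => C.edge_vert hy.symm
    refine ⟨hC.1.subset hsub, ?_⟩
    by_cases h : v ∈ C.verts
    · exact (hC.2.2.2 v h).le.trans (by norm_num)
    · have : C.spanningCoe.neighborSet v = ∅ := by
        ext y
        simpa using fun hy : C.Adj v y => h (C.edge_vert hy)
      simp [this]
  · refine reachable_map_of_adj id (fun x y hxy => Adj.reachable ?_)
      ((subgraph_connected_iff.1 hC.2.2.1).2 u hu v hv)
    exact ⟨hxy, fun h => hw (h ▸ C.edge_vert hxy), fun h => hw (h ▸ C.edge_vert hxy.symm)⟩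

lemma IsCycleSub.exists_three_verts {G : SimpleGraph V} {C : G.Subgraph} (hC : IsCycleSub C) :
    ∃ a ∈ C.verts, ∃ b ∈ C.verts, ∃ c ∈ C.verts, a ≠ b ∧ a ≠ c ∧ b ≠ c := by
  obtain ⟨a, ha⟩ := hC.2.1
  obtain ⟨b, c, hbc, h⟩ := Set.ncard_eq_two.1 (hC.2.2.2 a ha)
  have hb : C.Adj a b := by rw [← Subgraph.mem_neighborSet, h]; simp
  have hc : C.Adj a c := by rw [← Subgraph.mem_neighborSet, h]; simp
  exact ⟨a, ha, b, C.edge_vert hb.symm, c, C.edge_vert hc.symm, hb.ne, hc.ne, hbc⟩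

/-- Any two vertices of a 2-connected graph lie on a common cycle. -/
lemma exists_isCycle_mem_support {E : SimpleGraph V} {S : Set V}
    (hin : ∀ a b, E.Adj a b → a ∈ S)
    (hedge : ∀ e, ∀ u ∈ S, ∀ v ∈ S, (E.deleteEdges {e}).Reachable u v)
    (hvert : ∀ w ∈ S, ∀ u ∈ S, ∀ v ∈ S, u ≠ w → v ≠ w → (del E {w}).Reachable u v)
    {u v : V} (hu : u ∈ S) (hv : v ∈ S) (hne : u ≠ v) :
    ∃ c : E.Walk u u, c.IsCycle ∧ v ∈ c.support := by
  classical
  suffices v = u ∨ ∃ c : E.Walk u u, c.IsCycle ∧ v ∈ c.support from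
    this.resolve_left hne.symm
  have hr : E.Reachable u v := (hedge s(u, u) u hu v hv).mono (deleteEdges_le _)
  refine prop_of_reachable (P := fun v => v = u ∨ ∃ c : E.Walk u u, c.IsCycle ∧ v ∈ c.support)
    (fun x y hxy hx => ?_) hr (Or.inl rfl)
  have hxS : x ∈ S := hin x y hxy
  have hyS : y ∈ S := hin y x hxy.symm
  by_cases hyu : y = u
  · exact Or.inl hyu
  right
  by_cases hxu : x = u
  · subst hxu
    obtain ⟨z, c, hc, he⟩ := adj_and_reachable_delete_edges_iff_exists_cycle.1
      ⟨hxy, hedge s(x, y) x hxS y hyS⟩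
    have hxc := c.fst_mem_support_of_mem_edges he
    exact ⟨c.rotate x hxc, hc.rotate _,
      (c.mem_support_rotate_iff _ _).2 (c.snd_mem_support_of_mem_edges he)⟩
  obtain ⟨c₀, hc₀, hxc₀⟩ := hx.resolve_left hxu
  by_cases hyc₀ : y ∈ c₀.support
  · exact ⟨c₀, hc₀, hyc₀⟩
  obtain ⟨c, hc, hcs⟩ : ∃ c : E.Walk x x, c.IsCycle ∧ ∀ z, z ∈ c.support ↔ z ∈ c₀.support :=
    ⟨c₀.rotate x hxc₀, hc₀.rotate _, fun z => c₀.mem_support_rotate_iff _ _⟩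
  have hyc : y ∉ c.support := fun h => hyc₀ ((hcs y).1 h)
  have huc : u ∈ c.support := (hcs u).2 c₀.start_mem_support
  have hdel : del E {x} ≤ E := fun _ _ h => h.1
  obtain ⟨q₀, hq₀⟩ := (hvert x hxS y hyS u hu hxy.ne' (Ne.symm hxu)).exists_isPath
  obtain ⟨q, hq, hxq⟩ : ∃ q : E.Walk y u, q.IsPath ∧ x ∉ q.support := by
    refine ⟨q₀.mapLe hdel, hq₀.mapLe hdel, ?_⟩
    rw [Walk.support_mapLe_eq_support]
    intro hx
    exact prop_of_reachable (P := (· ≠ x)) (fun _ _ (h : (del E {x}).Adj _ _) _ => h.2.2)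
      (⟨q₀.takeUntil x hx⟩ : (del E {x}).Reachable y x) hxy.ne' rfl
  obtain ⟨z, hzc, hzq, hz⟩ := q.exists_mem_support_forall_mem_support_imp_eq c.support.toFinset
    ⟨u, by simpa using huc⟩
  rw [List.mem_toFinset] at hzc
  have hzx : z ≠ x := fun h => hxq (h ▸ hzq)
  obtain ⟨p, hp, hup, hpc⟩ : ∃ p : E.Walk x z, p.IsPath ∧ u ∈ p.support ∧
      ∀ t ∈ p.support, t ∈ c.support := by
    have hsp := c.take_spec hzc
    have hu' := huc
    rw [← hsp, Walk.mem_support_append_iff] at hu'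
    rcases hu' with h | h
    · exact ⟨_, hc.isPath_takeUntil hzc, h, fun t ht => c.support_takeUntil_subset_support hzc ht⟩
    · refine ⟨(c.dropUntil z hzc).reverse, ?_, by simpa using h,
        fun t ht => c.support_dropUntil_subset_support hzc (by simpa using ht)⟩
      rw [Walk.isPath_reverse_iff]
      rw [← hsp] at hc
      exact hc.isPath_of_append_right (Walk.not_nil_of_ne hzx.symm)
  set q₁ := q.takeUntil z hzq
  have hq₁p : q₁.IsPath := hq.takeUntil hzq
  have hxq₁ : x ∉ q₁.support := fun h => hxq (q.support_takeUntil_subset_support hzq h)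
  have hpath : (p.append q₁.reverse).IsPath := by
    rw [Walk.isPath_def, Walk.support_append, List.nodup_append']
    have hr : q₁.reverse.support.Nodup := hq₁p.reverse.support_nodup
    refine ⟨hp.support_nodup, hr.sublist (List.tail_sublist _), fun t ht ht' => ?_⟩
    have htq : t ∈ q₁.support := by
      have := List.mem_of_mem_tail ht'
      simpa using this
    have htz := hz t (by simpa using hpc t ht) htq
    subst htz
    rw [← Walk.cons_tail_support, List.nodup_cons] at hr
    exact hr.1 ht'
  have hcyc : (Walk.cons hxy.symm (p.append q₁.reverse)).IsCycle := by
    rw [Walk.cons_isCycle_iff]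
    refine ⟨hpath, fun he => ?_⟩
    rw [Walk.edges_append, List.mem_append] at he
    rcases he with h | h
    · exact hyc (hpc y (p.fst_mem_support_of_mem_edges h))
    · have := q₁.reverse.snd_mem_support_of_mem_edges h
      exact hxq₁ (by simpa using this)
  have hmem : u ∈ (Walk.cons hxy.symm (p.append q₁.reverse)).support := by
    simp [Walk.mem_support_append_iff, hup]
  exact ⟨_, hcyc.rotate hmem, (Walk.mem_support_rotate_iff _ _ hmem).2 (Walk.start_mem_support _)⟩

/-- A vertex of `F` at which a new edge may be attached: it lies on a cycle of `F` or has degree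
at most one in `F`. -/
def Attachable {G : SimpleGraph V} (F : G.Subgraph) (u : V) : Prop :=
  (∃ C ≤ F, IsCycleSub C ∧ u ∈ C.verts) ∨ (F.neighborSet u).ncard ≤ 1

/-- `F` is a finite cactus, with its cycles regarded as subgraphs of `G`. -/
structure FinCactus {G : SimpleGraph V} (F : G.Subgraph) : Prop where
  finite : F.verts.Finite
  connected : F.Connected
  disjoint : ∀ C₁ ≤ F, ∀ C₂ ≤ F, IsCycleSub C₁ → IsCycleSub C₂ → C₁ ≠ C₂ →
    Disjoint C₁.verts C₂.verts
  degree_le : ∀ v ∈ F.verts, (∀ C ≤ F, IsCycleSub C → v ∉ C.verts) → (F.neighborSet v).ncard ≤ 2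

lemma IsCycleSub.eq_of_le {G : SimpleGraph V} {C P : G.Subgraph} (hC : IsCycleSub C)
    (hP : IsCycleSub P) (h : C ≤ P) : C = P := by
  have hfin : ∀ v, (P.neighborSet v).Finite := fun v =>
    hP.1.subset fun y (hy : P.Adj v y) => P.edge_vert hy.symm
  have hN : ∀ v ∈ C.verts, C.neighborSet v = P.neighborSet v := fun v hv =>
    Set.eq_of_subset_of_ncard_le (fun y (hy : C.Adj v y) => h.2 hy)
      (by rw [hC.2.2.2 v hv, hP.2.2.2 v (h.1 hv)]) (hfin v)
  have hstep : ∀ x y, P.Adj x y → x ∈ C.verts → C.Adj x y := fun x y hxy hx => by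
    have : y ∈ P.neighborSet x := hxy
    rwa [← hN x hx] at this
  obtain ⟨c, hc⟩ := hC.2.1
  have hverts : ∀ v ∈ P.verts, v ∈ C.verts := fun v hv =>
    prop_of_reachable (P := (· ∈ C.verts)) (fun x y hxy hx => C.edge_vert (hstep x y hxy hx).symm)
      ((subgraph_connected_iff.1 hP.2.2.1).2 c (h.1 hc) v hv) hc
  exact le_antisymm h ⟨hverts, fun x y hxy => hstep x y hxy (hverts x (P.edge_vert hxy))⟩

lemma le_of_adj_imp_or {G : SimpleGraph V} {C F P : G.Subgraph} (hC : C.Connected)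
    (hFP : Disjoint F.verts P.verts) (hadj : ∀ x y, C.Adj x y → F.Adj x y ∨ P.Adj x y)
    {v : V} (hvC : v ∈ C.verts) (hvF : v ∈ F.verts) : C ≤ F := by
  have hF : ∀ x y, C.Adj x y → x ∈ F.verts → F.Adj x y := fun x y hxy hx =>
    (hadj x y hxy).resolve_right fun h => Set.disjoint_left.1 hFP hx (P.edge_vert h)
  have hverts : ∀ x ∈ C.verts, x ∈ F.verts := fun x hx =>
    prop_of_reachable (P := (· ∈ F.verts)) (fun x y hxy hx => F.edge_vert (hF x y hxy hx).symm)
      ((subgraph_connected_iff.1 hC).2 v hvC x hx) hvF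
  exact ⟨hverts, fun x y hxy => hF x y hxy (hverts x (C.edge_vert hxy))⟩

/-- A cycle in the union of two disjoint subgraphs and one edge between them lies in one of the
two subgraphs. -/
lemma IsCycleSub.le_or_le {G : SimpleGraph V} {C F P : G.Subgraph} (hC : IsCycleSub C)
    (hFP : Disjoint F.verts P.verts) {u a : V} (hu : u ∈ F.verts) (ha : a ∈ P.verts)
    (hua : G.Adj u a) (hle : C ≤ F ⊔ P ⊔ G.subgraphOfAdj hua) : C ≤ F ∨ C ≤ P := by
  have hadj : ∀ x y, C.Adj x y → s(x, y) ≠ s(u, a) → F.Adj x y ∨ P.Adj x y := by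
    intro x y hxy hne
    have := hle.2 hxy
    rw [Subgraph.sup_adj, Subgraph.sup_adj, subgraphOfAdj_adj] at this
    exact this.resolve_right fun h => hne h.symm
  have hnot : ¬ C.Adj u a := by
    intro hcon
    have hr := hC.reachable_deleteEdges s(u, a) (C.edge_vert hcon) (C.edge_vert hcon.symm)
    refine Set.disjoint_left.1 hFP (prop_of_reachable (P := (· ∈ F.verts)) (fun x y hxy hx => ?_)
      hr hu) ha
    rw [deleteEdges_adj] at hxy
    rcases hadj x y hxy.1 hxy.2 with h | h
    · exact F.edge_vert h.symm
    · exact absurd (P.edge_vert h) (Set.disjoint_left.1 hFP hx)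
  have hadj' : ∀ x y, C.Adj x y → F.Adj x y ∨ P.Adj x y := by
    refine fun x y hxy => hadj x y hxy fun he => hnot ?_
    rcases Sym2.eq_iff.1 he with ⟨rfl, rfl⟩ | ⟨rfl, rfl⟩
    exacts [hxy, hxy.symm]
  obtain ⟨v, hv⟩ := hC.2.1
  have hvFP : v ∈ F.verts ∨ v ∈ P.verts := by
    have h := hle.1 hv
    rcases h with h | h
    · exact h
    · rcases h with rfl | rfl
      exacts [Or.inl hu, Or.inr ha]
  rcases hvFP with h | h
  · exact Or.inl (le_of_adj_imp_or hC.2.2.1 hFP hadj' hv h)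
  · exact Or.inr (le_of_adj_imp_or hC.2.2.1 hFP.symm (fun x y hxy => (hadj' x y hxy).symm) hv h)

/-- A finite cactus may be extended by a disjoint cycle or vertex joined by one edge. -/
lemma FinCactus.attach {G : SimpleGraph V} {F P : G.Subgraph} (hF : FinCactus F)
    (hFP : Disjoint F.verts P.verts) {u a : V} (hu : u ∈ F.verts) (hatt : Attachable F u)
    (ha : a ∈ P.verts) (hua : G.Adj u a) (hP : IsCycleSub P ∨ P = G.singletonSubgraph a) :
    ∃ F' : G.Subgraph, FinCactus F' ∧ F ≤ F' ∧ P ≤ F' ∧ F'.verts = F.verts ∪ P.verts ∧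
      (∀ v ∈ F.verts, Attachable F v → (v = u → ∃ C ≤ F, IsCycleSub C ∧ u ∈ C.verts) →
        Attachable F' v) ∧
      ∀ v ∈ P.verts, Attachable F' v := by
  set F' := F ⊔ P ⊔ G.subgraphOfAdj hua with hF'
  have hFF' : F ≤ F' := le_sup_left.trans le_sup_left
  have hPF' : P ≤ F' := le_sup_right.trans le_sup_left
  have hverts : F'.verts = F.verts ∪ P.verts := by
    ext y
    simp only [hF', Subgraph.verts_sup, subgraphOfAdj_verts, Set.mem_union, Set.mem_insert_iff,
      Set.mem_singleton_iff]
    constructor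
    · rintro ((h | h) | rfl | rfl)
      exacts [Or.inl h, Or.inr h, Or.inl hu, Or.inr ha]
    · exact fun h => Or.inl h
  have hadj : ∀ x y, F'.Adj x y ↔ (F.Adj x y ∨ P.Adj x y) ∨ s(u, a) = s(x, y) := fun x y => by
    rw [hF', Subgraph.sup_adj, Subgraph.sup_adj, subgraphOfAdj_adj]
  have haF : a ∉ F.verts := fun h => Set.disjoint_left.1 hFP h ha
  have hPconn : P.Connected := by
    rcases hP with h | rfl
    exacts [h.2.2.1, Subgraph.singletonSubgraph_connected]
  have hPfin : P.verts.Finite := by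
    rcases hP with h | rfl
    exacts [h.1, Set.finite_singleton _]
  have hN : ∀ v ∈ F.verts, v ≠ u → F'.neighborSet v = F.neighborSet v := by
    intro v hv hvu
    ext y
    rw [Subgraph.mem_neighborSet, Subgraph.mem_neighborSet, hadj]
    refine ⟨?_, fun h => Or.inl (Or.inl h)⟩
    rintro ((h | h) | h)
    · exact h
    · exact absurd (P.edge_vert h) (Set.disjoint_left.1 hFP hv)
    · rcases Sym2.eq_iff.1 h with ⟨rfl, rfl⟩ | ⟨rfl, rfl⟩
      exacts [absurd rfl hvu, absurd hv haF]
  have hNu : F'.neighborSet u ⊆ insert a (F.neighborSet u) := by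
    intro y hy
    rw [Subgraph.mem_neighborSet, hadj] at hy
    rcases hy with (h | h) | h
    · exact Or.inr h
    · exact absurd (P.edge_vert h) (Set.disjoint_left.1 hFP hu)
    · rcases Sym2.eq_iff.1 h with ⟨_, rfl⟩ | ⟨rfl, rfl⟩
      exacts [Or.inl rfl, Or.inl rfl]
  have hNP : P = G.singletonSubgraph a → F'.neighborSet a ⊆ {u} := by
    rintro rfl y hy
    rw [Subgraph.mem_neighborSet, hadj] at hy
    rcases hy with (h | h) | h
    · exact absurd (F.edge_vert h) haF
    · exact absurd h (by simp)
    · rcases Sym2.eq_iff.1 h with ⟨h, _⟩ | ⟨h, _⟩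
      exacts [absurd h hua.ne, h.symm]
  have hNfin : ∀ v, (F.neighborSet v).Finite := fun v =>
    hF.finite.subset fun y (hy : F.Adj v y) => F.edge_vert hy.symm
  have hattP : ∀ v ∈ P.verts, Attachable F' v := by
    intro v hv
    rcases hP with h | h
    · exact Or.inl ⟨P, hPF', h, hv⟩
    · right
      have : v = a := by rw [h] at hv; exact hv
      subst this
      exact (Set.ncard_le_ncard (hNP h)).trans (by simp)
  refine ⟨F', ⟨?_, ?_, ?_, ?_⟩, hFF', hPF', hverts, ?_, hattP⟩
  · rw [hverts]
    exact hF.finite.union hPfin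
  · have h1 := Subgraph.connected_sup hF.connected.preconnected
      (Subgraph.subgraphOfAdj_connected hua).preconnected ⟨u, hu, by simp⟩
    have h2 := Subgraph.connected_sup h1.preconnected hPconn.preconnected
      ⟨a, by simp, ha⟩
    rwa [hF', sup_right_comm]
  · intro C₁ h₁ C₂ h₂ hC₁ hC₂ hne
    have hcyc : ∀ C, C ≤ P → IsCycleSub C → C = P := by
      intro C hCP hC
      rcases hP with h | rfl
      · exact hC.eq_of_le h hCP
      · obtain ⟨x, hx, y, hy, _, _, hxy, _⟩ := hC.exists_three_verts
        have h1 : x = a := hCP.1 hx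
        have h2 : y = a := hCP.1 hy
        exact absurd (h1.trans h2.symm) hxy
    rcases hC₁.le_or_le hFP hu ha hua h₁ with h₁ | h₁ <;>
      rcases hC₂.le_or_le hFP hu ha hua h₂ with h₂ | h₂
    · exact hF.disjoint C₁ h₁ C₂ h₂ hC₁ hC₂ hne
    · exact hFP.mono h₁.1 h₂.1
    · exact (hFP.mono h₂.1 h₁.1).symm
    · exact absurd ((hcyc C₁ h₁ hC₁).trans (hcyc C₂ h₂ hC₂).symm) hne
  · intro v hv hno
    rw [hverts] at hv
    rcases hv with hv | hv
    · by_cases hvu : v = u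
      · subst hvu
        rcases hatt with ⟨C, hCF, hC, hvC⟩ | h
        · exact absurd hvC (hno C (hCF.trans hFF') hC)
        · refine (Set.ncard_le_ncard hNu ((hNfin v).insert a)).trans ?_
          exact (Set.ncard_insert_le _ _).trans (by omega)
      · rw [hN v hv hvu]
        exact hF.degree_le v hv fun C hC => hno C (hC.trans hFF')
    · rcases hattP v hv with ⟨C, hCF, hC, hvC⟩ | h
      · exact absurd hvC (hno C hCF hC)
      · omega
  · intro v hv hav hvu
    rcases hav with ⟨C, hCF, hC, hvC⟩ | h
    · exact Or.inl ⟨C, hCF.trans hFF', hC, hvC⟩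
    · by_cases h' : v = u
      · obtain ⟨C, hCF, hC, huC⟩ := hvu h'
        exact Or.inl ⟨C, hCF.trans hFF', hC, h' ▸ huC⟩
      · right
        rwa [hN v hv h']

lemma IsCycleSub.finCactus {G : SimpleGraph V} {C : G.Subgraph} (hC : IsCycleSub C) :
    FinCactus C where
  finite := hC.1
  connected := hC.2.2.1
  disjoint C₁ h₁ C₂ h₂ hC₁ hC₂ hne :=
    absurd ((hC₁.eq_of_le hC h₁).trans (hC₂.eq_of_le hC h₂).symm) hne
  degree_le v hv _ := (hC.2.2.2 v hv).le

lemma isCycleSub_coeSubgraph_iff {G : SimpleGraph V} {F : G.Subgraph} (D : F.coe.Subgraph) :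
    IsCycleSub (Subgraph.coeSubgraph D) ↔ IsCycleSub D := by
  have hadj : ∀ x y : F.verts, (Subgraph.coeSubgraph D).Adj x y ↔ D.Adj x y := fun x y => by
    rw [Subgraph.coeSubgraph_adj]
    exact ⟨fun ⟨_, _, h⟩ => h, fun h => ⟨x.2, y.2, h⟩⟩
  have hv : (Subgraph.coeSubgraph D).verts = Subtype.val '' D.verts := rfl
  have hmem : ∀ x : F.verts, (x : V) ∈ (Subgraph.coeSubgraph D).verts ↔ x ∈ D.verts := fun x => by
    rw [hv]; simp
  have hN : ∀ x : F.verts,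
      ((Subgraph.coeSubgraph D).neighborSet x).ncard = (D.neighborSet x).ncard := fun x => by
    rw [← Set.ncard_image_of_injective _ Subtype.val_injective]
    congr 1
    ext y
    rw [Subgraph.mem_neighborSet, Subgraph.coeSubgraph_adj]
    simp
  unfold IsCycleSub
  refine and_congr ?_ (and_congr ?_ (and_congr ?_ ?_))
  · rw [hv]; exact Set.finite_image_iff Subtype.val_injective.injOn
  · rw [hv]; exact Set.image_nonempty
  · refine ⟨fun h => ?_, fun h => Subgraph.Connected.coeSubgraph D h⟩
    rw [subgraph_connected_iff] at h ⊢
    rw [hv, Set.image_nonempty] at h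
    refine ⟨h.1, fun x hx y hy => ?_⟩
    obtain ⟨_, h'⟩ := prop_of_reachable
      (P := fun z => ∃ hz : z ∈ F.verts, D.spanningCoe.Reachable x ⟨z, hz⟩)
      (fun a b hab ⟨ha, hr⟩ => by
        obtain ⟨_, hb, h⟩ := (Subgraph.coeSubgraph_adj D a b).1 hab
        exact ⟨hb, hr.trans (Adj.reachable h)⟩)
      (h.2 x ⟨x, hx, rfl⟩ y ⟨y, hy, rfl⟩) ⟨x.2, Reachable.refl _⟩
    exact h'
  · rw [hv, Set.forall_mem_image]
    exact forall₂_congr fun x _ => by rw [hN x]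

lemma FinCactus.isCactus {G : SimpleGraph V} (hsc : Subcubic G) {F : G.Subgraph}
    (hF : FinCactus F) : IsCactus F.coe := by
  have : Finite F.verts := hF.finite
  refine ⟨hF.connected.coe, fun v => ⟨Set.toFinite _, ?_⟩, fun C₁ C₂ h₁ h₂ hne => ?_,
    fun v hv => ?_⟩
  · rw [ncard_neighborSet_coe]
    exact (Set.ncard_le_ncard (F.neighborSet_subset v) (hsc v).1).trans (hsc v).2
  · have := hF.disjoint _ (Subgraph.coeSubgraph_le C₁) _ (Subgraph.coeSubgraph_le C₂)
      ((isCycleSub_coeSubgraph_iff C₁).2 h₁) ((isCycleSub_coeSubgraph_iff C₂).2 h₂)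
      (fun h => hne (Subgraph.coeSubgraph_injective F h))
    exact (Set.disjoint_image_iff Subtype.val_injective).1 this
  · rw [ncard_neighborSet_coe]
    refine hF.degree_le v v.2 fun C hCF hC hvC => ?_
    have heq : Subgraph.coeSubgraph (F.restrict C) = C := by
      rw [Subgraph.coeSubgraph_restrict_eq, inf_eq_right.2 hCF]
    exact hv (F.restrict C) ((isCycleSub_coeSubgraph_iff _).1 (heq.symm ▸ hC)) hvC

/-- The vertex set of the component of `G[Z]` containing `z`. -/
def compIn (G : SimpleGraph V) (Z : Set V) (z : V) : Set V := {v | (inside G Z).Reachable z v}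

lemma compIn_subset {G : SimpleGraph V} {Z : Set V} {z : V} (hz : z ∈ Z) : compIn G Z z ⊆ Z :=
  fun _ hv => mem_of_reachable_inside hv hz

lemma self_mem_compIn (G : SimpleGraph V) (Z : Set V) (z : V) : z ∈ compIn G Z z :=
  Reachable.refl _

lemma compIn_eq_of_mem {G : SimpleGraph V} {Z : Set V} {z t : V} (h : t ∈ compIn G Z z) :
    compIn G Z t = compIn G Z z :=
  Set.ext fun _ => ⟨fun h' => Reachable.trans h h', fun h' => Reachable.trans h.symm h'⟩

lemma mem_compIn_of_adj {G : SimpleGraph V} {Z : Set V} {z x y : V} (hz : z ∈ Z)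
    (hx : x ∈ compIn G Z z) (hy : y ∈ Z) (hxy : G.Adj x y) : y ∈ compIn G Z z :=
  Reachable.trans hx (Adj.reachable ⟨hxy, compIn_subset hz hx, hy⟩)

lemma reachable_inside_compIn {G : SimpleGraph V} {Z : Set V} {z s t : V}
    (hs : s ∈ compIn G Z z) (ht : t ∈ compIn G Z z) :
    (inside G (compIn G Z z)).Reachable s t := by
  have key : ∀ v, v ∈ compIn G Z z → (inside G (compIn G Z z)).Reachable z v := fun v hv =>
    (prop_of_reachable
      (P := fun v => (inside G Z).Reachable z v ∧ (inside G (compIn G Z z)).Reachable z v)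
      (fun x y hxy hx => by
        have hy : (inside G Z).Reachable z y := hx.1.trans (Adj.reachable hxy)
        exact ⟨hy, hx.2.trans (Adj.reachable ⟨hxy.1, hx.1, hy⟩)⟩)
      hv ⟨Reachable.refl _, Reachable.refl _⟩).2
  exact (key s hs).symm.trans (key t ht)

lemma pairwiseDisjoint_compIn (G : SimpleGraph V) (Z : Set V) :
    (compIn G Z '' Z).PairwiseDisjoint id := by
  rintro _ ⟨z, _, rfl⟩ _ ⟨t, _, rfl⟩ hne
  refine Set.disjoint_left.2 fun v hv hv' => hne ?_
  exact (compIn_eq_of_mem hv).symm.trans (compIn_eq_of_mem hv')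

lemma finite_compIn_image {G : SimpleGraph V} {Z A : Set V} (hA : A.Finite)
    (h : ∀ z ∈ Z, ∃ t ∈ compIn G Z z, t ∈ A) : (compIn G Z '' Z).Finite := by
  refine (hA.image (compIn G Z)).subset ?_
  rintro _ ⟨z, hz, rfl⟩
  obtain ⟨t, ht, htA⟩ := h z hz
  exact ⟨t, htA, compIn_eq_of_mem ht⟩

/-- A criterion for `G[T]` to be 2-connected. -/
lemma isKConn_two_induce {G : SimpleGraph V} {T : Set V}
    (hthree : ∃ a ∈ T, ∃ b ∈ T, ∃ c ∈ T, a ≠ b ∧ a ≠ c ∧ b ≠ c)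
    (hT : ∀ q ∈ T, ∀ u ∈ T, ∀ v ∈ T, u ≠ q → v ≠ q → (inside G (T \ {q})).Reachable u v) :
    IsKConn 2 (G.induce T) := by
  obtain ⟨a, ha, b, hb, c, hc, hab, hac, hbc⟩ := hthree
  have hother : ∀ u v : V, ∃ q ∈ T, u ≠ q ∧ v ≠ q := by
    intro u v
    by_cases h1 : u ≠ a ∧ v ≠ a
    · exact ⟨a, ha, h1⟩
    by_cases h2 : u ≠ b ∧ v ≠ b
    · exact ⟨b, hb, h2⟩
    · refine ⟨c, hc, ?_⟩
      grind
  constructor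
  · have : ((2 : ℕ) : Cardinal) < ((3 : ℕ) : Cardinal) := by exact_mod_cast (by norm_num)
    refine this.trans_le ?_
    have hinj : Function.Injective ![(⟨a, ha⟩ : T), ⟨b, hb⟩, ⟨c, hc⟩] := by
      intro i j hij
      fin_cases i <;> fin_cases j <;> simp_all [eq_comm]
    simpa using Cardinal.lift_mk_le_lift_mk_of_injective hinj
  · intro X hX hX2
    have hq : ∀ u v : T, u ∉ X → v ∉ X → ∃ q ∈ T, (u : V) ≠ q ∧ (v : V) ≠ q ∧
        ∀ x ∈ X, (x : V) = q := by
      intro u v hu hv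
      rcases Set.eq_empty_or_nonempty X with rfl | ⟨q, hqX⟩
      · obtain ⟨q, hq, h⟩ := hother u v
        exact ⟨q, hq, h.1, h.2, by simp⟩
      · refine ⟨q, q.2, fun h => hu ?_, fun h => hv ?_, fun x hx => ?_⟩
        · rwa [Subtype.ext h]
        · rwa [Subtype.ext h]
        · rw [(Set.ncard_le_one hX).1 (by omega) x hx q hqX]
    have hpre : ((G.induce T).induce Xᶜ).Preconnected := by
      rintro ⟨u, hu⟩ ⟨v, hv⟩
      obtain ⟨q, hqT, huq, hvq, hXq⟩ := hq u v hu hv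
      obtain ⟨_, _, h⟩ := prop_of_reachable
        (P := fun y => ∃ (hy : y ∈ T) (hy' : (⟨y, hy⟩ : T) ∈ Xᶜ),
          ((G.induce T).induce Xᶜ).Reachable ⟨u, hu⟩ ⟨⟨y, hy⟩, hy'⟩)
        (fun x y (hxy : (inside G (T \ {q})).Adj x y) ⟨hx, hx', hr⟩ =>
          ⟨hxy.2.2.1, fun h => hxy.2.2.2 (hXq _ h), hr.trans (Adj.reachable hxy.1)⟩)
        (hT q hqT u u.2 v v.2 huq hvq) ⟨u.2, hu, Reachable.refl _⟩
      exact h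
    have hne : ∃ u : T, u ∉ X := by
      by_contra! hall
      have := (Set.ncard_le_one hX).1 (by omega) ⟨a, ha⟩ (hall _) ⟨b, hb⟩ (hall _)
      exact hab (congrArg Subtype.val this)
    obtain ⟨u, hu⟩ := hne
    have : Nonempty (Xᶜ : Set T) := ⟨⟨u, hu⟩⟩
    exact ⟨hpre⟩

/-- In a 2-connected graph, a cycle together with a component of its complement induces a
2-connected graph. -/
lemma isKConn_two_compIn_union {G : SimpleGraph V} {S : Set V}
    (hvert : ∀ q ∈ S, ∀ u ∈ S, ∀ v ∈ S, u ≠ q → v ≠ q → (del (inside G S) {q}).Reachable u v)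
    {C : G.Subgraph} (hC : IsCycleSub C) (hCS : C.verts ⊆ S) {w : V} (hw : w ∈ S \ C.verts) :
    IsKConn 2 (G.induce (compIn G (S \ C.verts) w ∪ C.verts)) := by
  obtain ⟨a, ha, b, hb, c, hc, hne⟩ := hC.exists_three_verts
  set K := compIn G (S \ C.verts) w
  have hKS : K ⊆ S \ C.verts := compIn_subset hw
  refine isKConn_two_induce ⟨a, Or.inr ha, b, Or.inr hb, c, Or.inr hc, hne⟩ ?_
  intro q hq
  have hqS : q ∈ S := hq.elim (fun h => (hKS h).1) (fun h => hCS h)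
  have hCC : ∀ u ∈ C.verts, ∀ v ∈ C.verts, u ≠ q → v ≠ q →
      (inside G ((K ∪ C.verts) \ {q})).Reachable u v := fun u hu v hv huq hvq =>
    (hC.reachable_del hu hv huq hvq).mono fun x y (hxy : (del C.spanningCoe {q}).Adj x y) =>
      ⟨C.adj_sub hxy.1, ⟨Or.inr (C.edge_vert hxy.1), hxy.2.1⟩,
        ⟨Or.inr (C.edge_vert hxy.1.symm), hxy.2.2⟩⟩
  obtain ⟨c₀, hc₀, hc₀q⟩ : ∃ c₀ ∈ C.verts, c₀ ≠ q := by
    by_cases h : a = q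
    · exact ⟨b, hb, fun h' => hne.1 (h.trans h'.symm)⟩
    · exact ⟨a, ha, h⟩
  have hto : ∀ u ∈ K ∪ C.verts, u ≠ q → ∃ c ∈ C.verts, c ≠ q ∧
      (inside G ((K ∪ C.verts) \ {q})).Reachable u c := by
    rintro u (hu | hu) huq
    · have := prop_of_reachable
        (P := fun v => (∃ c ∈ C.verts, c ≠ q ∧
          (inside G ((K ∪ C.verts) \ {q})).Reachable u c) ∨
          (v ∈ K ∧ (inside G ((K ∪ C.verts) \ {q})).Reachable u v))
        (fun x y hxy hx => by
          rcases hx with hx | ⟨hxK, hx⟩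
          · exact Or.inl hx
          · by_cases hyC : y ∈ C.verts
            · exact Or.inl ⟨y, hyC, hxy.2.2, hx.trans (Adj.reachable
                ⟨hxy.1.1, ⟨Or.inl hxK, hxy.2.1⟩, ⟨Or.inr hyC, hxy.2.2⟩⟩)⟩
            · have hyK : y ∈ K := mem_compIn_of_adj hw hxK ⟨hxy.1.2.2, hyC⟩ hxy.1.1
              exact Or.inr ⟨hyK, hx.trans (Adj.reachable
                ⟨hxy.1.1, ⟨Or.inl hxK, hxy.2.1⟩, ⟨Or.inl hyK, hxy.2.2⟩⟩)⟩)
        (hvert q hqS u (hKS hu).1 c₀ (hCS hc₀) huq hc₀q) (Or.inr ⟨hu, Reachable.refl _⟩)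
      exact this.resolve_right fun h => (hKS h.1).2 hc₀
    · exact ⟨u, hu, huq, Reachable.refl _⟩
  intro u hu v hv huq hvq
  obtain ⟨c₁, h₁, hq₁, hr₁⟩ := hto u hu huq
  obtain ⟨c₂, h₂, hq₂, hr₂⟩ := hto v hv hvq
  exact hr₁.trans ((hCC c₁ h₁ c₂ h₂ hq₁ hq₂).trans hr₂.symm)

/-- The vertices of `Y` not separated from `r` in `G[Y]` by a single edge. -/
def edgeCore (G : SimpleGraph V) (Y : Set V) (r : V) : Set V :=
  {v | ∀ e : Sym2 V, ((inside G Y).deleteEdges {e}).Reachable r v}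

lemma self_mem_edgeCore (G : SimpleGraph V) (Y : Set V) (r : V) : r ∈ edgeCore G Y r :=
  fun _ => Reachable.refl _

lemma edgeCore_subset {G : SimpleGraph V} {Y : Set V} {r : V} (hr : r ∈ Y) :
    edgeCore G Y r ⊆ Y :=
  fun _ hv => mem_of_reachable_inside ((hv s(r, r)).mono (deleteEdges_le _)) hr

/-- A component outside the core is joined to the core by at most one edge. -/
lemma edgeCore_exit_unique {G : SimpleGraph V} {Y : Set V} {r : V} (hr : r ∈ Y)
    {k₁ k₂ b₁ b₂ : V} (hk₁ : k₁ ∈ Y \ edgeCore G Y r)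
    (hk : k₂ ∈ compIn G (Y \ edgeCore G Y r) k₁)
    (hb₁ : b₁ ∈ edgeCore G Y r) (hb₂ : b₂ ∈ edgeCore G Y r)
    (h₁ : G.Adj k₁ b₁) (h₂ : G.Adj k₂ b₂) : k₁ = k₂ ∧ b₁ = b₂ := by
  have hk₂ := compIn_subset hk₁ hk
  by_contra hne
  refine hk₁.2 fun e => ?_
  by_cases he : e = s(k₁, b₁)
  · subst he
    have hstep : ((inside G Y).deleteEdges {s(k₁, b₁)}).Adj b₂ k₂ := by
      rw [deleteEdges_adj]
      refine ⟨⟨h₂.symm, edgeCore_subset hr hb₂, hk₂.1⟩, fun h => ?_⟩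
      rcases Sym2.eq_iff.1 h with ⟨h, _⟩ | ⟨h, h'⟩
      · exact hk₁.2 (h ▸ hb₂)
      · exact hne ⟨h'.symm, h.symm⟩
    refine (hb₂ _).trans (hstep.reachable.trans ?_)
    refine Reachable.mono (fun x y hxy => ?_) (Reachable.symm hk)
    rw [deleteEdges_adj]
    refine ⟨⟨hxy.1, hxy.2.1.1, hxy.2.2.1⟩, fun h => ?_⟩
    rcases Sym2.eq_iff.1 h with ⟨_, h⟩ | ⟨h, _⟩
    · exact hxy.2.2.2 (h ▸ hb₁)
    · exact hxy.2.1.2 (h ▸ hb₁)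
  · refine (hb₁ e).trans (Adj.reachable ?_)
    rw [deleteEdges_adj]
    refine ⟨⟨h₁.symm, edgeCore_subset hr hb₁, hk₁.1⟩, fun h => he ?_⟩
    rw [← (h : s(b₁, k₁) = e), Sym2.eq_swap]

lemma exists_exit_edgeCore {G : SimpleGraph V} {Y : Set V} {r : V}
    (hconn : ∀ y ∈ Y, (inside G Y).Reachable r y) {z : V} (hz : z ∈ Y \ edgeCore G Y r) :
    ∃ k ∈ compIn G (Y \ edgeCore G Y r) z, ∃ b ∈ edgeCore G Y r, G.Adj k b := by
  have := prop_of_reachable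
    (P := fun v => (∃ k ∈ compIn G (Y \ edgeCore G Y r) z, ∃ b ∈ edgeCore G Y r, G.Adj k b) ∨
      v ∈ compIn G (Y \ edgeCore G Y r) z)
    (fun x y hxy hx => by
      rcases hx with hx | hx
      · exact Or.inl hx
      · by_cases hy : y ∈ edgeCore G Y r
        · exact Or.inl ⟨x, hx, y, hy, hxy.1⟩
        · exact Or.inr (mem_compIn_of_adj hz hx ⟨hxy.2.2, hy⟩ hxy.1))
    (hconn z hz.1).symm (Or.inr (self_mem_compIn _ _ _))
  exact this.resolve_right fun h => (compIn_subset hz h).2 (self_mem_edgeCore G Y r)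

/-- The graph induced by the core remains connected after deleting an edge. -/
lemma edgeCore_reachable_deleteEdges {G : SimpleGraph V} {Y : Set V} {r : V} (hr : r ∈ Y)
    (hconn : ∀ y ∈ Y, (inside G Y).Reachable r y) (e : Sym2 V) {u v : V}
    (hu : u ∈ edgeCore G Y r) (hv : v ∈ edgeCore G Y r) :
    ((inside G (edgeCore G Y r)).deleteEdges {e}).Reachable u v := by
  have hπ : ∀ y, ∃ b, (y ∈ edgeCore G Y r → b = y) ∧ (y ∈ Y \ edgeCore G Y r →
      b ∈ edgeCore G Y r ∧ ∃ k ∈ compIn G (Y \ edgeCore G Y r) y, G.Adj k b) := by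
    intro y
    by_cases hy : y ∈ Y \ edgeCore G Y r
    · obtain ⟨k, hk, b, hb, hkb⟩ := exists_exit_edgeCore hconn hy
      exact ⟨b, fun h => absurd h hy.2, fun _ => ⟨hb, k, hk, hkb⟩⟩
    · exact ⟨y, fun _ => rfl, fun h => absurd h hy⟩
  choose π hπ₁ hπ₂ using hπ
  have hcross : ∀ x ∈ edgeCore G Y r, ∀ y ∈ Y \ edgeCore G Y r, G.Adj x y → π y = x := by
    intro x hx y hy hxy
    obtain ⟨hb, k, hk, hkb⟩ := hπ₂ y hy
    exact (edgeCore_exit_unique hr hy hk hx hb hxy.symm hkb).2.symm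
  have key : ∀ v ∈ edgeCore G Y r,
      ((inside G (edgeCore G Y r)).deleteEdges {e}).Reachable r v := by
    intro v hv
    have := reachable_map_of_adj (H' := (inside G (edgeCore G Y r)).deleteEdges {e}) π
      (fun x y hxy => ?_) (hv e)
    · rwa [hπ₁ v hv, hπ₁ r (self_mem_edgeCore G Y r)] at this
    rw [deleteEdges_adj] at hxy
    obtain ⟨⟨hadj, hxY, hyY⟩, he⟩ := hxy
    by_cases hx : x ∈ edgeCore G Y r <;> by_cases hy : y ∈ edgeCore G Y r
    · rw [hπ₁ x hx, hπ₁ y hy]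
      exact Adj.reachable (by rw [deleteEdges_adj]; exact ⟨⟨hadj, hx, hy⟩, he⟩)
    · rw [hπ₁ x hx, hcross x hx y ⟨hyY, hy⟩ hadj]
    · rw [hπ₁ y hy, hcross y hy x ⟨hxY, hx⟩ hadj.symm]
    · have hxZ : x ∈ Y \ edgeCore G Y r := ⟨hxY, hx⟩
      obtain ⟨hb, k, hk, hkb⟩ := hπ₂ x hxZ
      obtain ⟨hb', k', hk', hkb'⟩ := hπ₂ y ⟨hyY, hy⟩
      have hxy : y ∈ compIn G (Y \ edgeCore G Y r) x :=
        mem_compIn_of_adj hxZ (self_mem_compIn _ _ _) ⟨hyY, hy⟩ hadj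
      rw [compIn_eq_of_mem hxy, ← compIn_eq_of_mem hk] at hk'
      rw [(edgeCore_exit_unique hr (compIn_subset hxZ hk) hk' hb hb' hkb hkb').2]
  exact (key u hu).symm.trans (key v hv)

lemma subcubic_inside {G : SimpleGraph V} (hsc : Subcubic G) (S : Set V) (v : V) :
    ((inside G S).neighborSet v).Finite ∧ ((inside G S).neighborSet v).ncard ≤ 3 := by
  have hsub : (inside G S).neighborSet v ⊆ G.neighborSet v :=
    fun y (hy : (inside G S).Adj v y) => hy.1
  exact ⟨(hsc v).1.subset hsub, (Set.ncard_le_ncard hsub (hsc v).1).trans (hsc v).2⟩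

/-- In a subcubic graph, two vertices of a 2-edge-connected set lie on a cycle inside it. -/
lemma exists_isCycleSub_inside {G : SimpleGraph V} (hsc : Subcubic G) {S : Set V}
    (hedge : ∀ e, ∀ u ∈ S, ∀ v ∈ S, ((inside G S).deleteEdges {e}).Reachable u v)
    {r a : V} (hr : r ∈ S) (ha : a ∈ S) (hS : S ≠ {r}) :
    ∃ C : G.Subgraph, IsCycleSub C ∧ C.verts ⊆ S ∧ r ∈ C.verts ∧ a ∈ C.verts := by
  wlog hra : r ≠ a generalizing a
  · obtain ⟨s, hs, hsr⟩ : ∃ s ∈ S, s ≠ r := by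
      by_contra! h
      exact hS (Set.Subset.antisymm h (Set.singleton_subset_iff.2 hr))
    obtain ⟨C, hC, hCS, hrC, _⟩ := this hs hsr.symm
    exact ⟨C, hC, hCS, hrC, not_ne_iff.1 hra ▸ hrC⟩
  obtain ⟨c, hc, hac⟩ := exists_isCycle_mem_support
    (fun x y (hxy : (inside G S).Adj x y) => hxy.2.1) hedge
    (fun w hw u hu v hv huw hvw =>
      reachable_del_of_reachable_deleteEdges (subcubic_inside hsc S) hedge hw hu hv huw hvw)
    hr ha hra
  have hmem : ∀ v, v ∈ (c.mapLe (inside_le G S)).toSubgraph.verts ↔ v ∈ c.support := fun v => by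
    rw [Walk.mem_verts_toSubgraph, Walk.support_mapLe_eq_support]
  refine ⟨(c.mapLe (inside_le G S)).toSubgraph,
    ⟨?_, ⟨r, (hmem r).2 c.start_mem_support⟩, Walk.toSubgraph_connected _, fun v hv => ?_⟩,
    fun v hv => ?_, (hmem r).2 c.start_mem_support, (hmem a).2 hac⟩
  · exact (List.finite_toSet c.support).subset fun v hv => (hmem v).1 hv
  · exact (hc.mapLe (inside_le G S)).ncard_neighborSet_toSubgraph_eq_two
      ((Walk.mem_verts_toSubgraph _).1 hv)
  · classical
    exact mem_of_reachable_inside ⟨c.takeUntil v ((hmem v).1 hv)⟩ hr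

lemma IsKConn.reachable_del {G : SimpleGraph V} (h2 : IsKConn 2 G) {w u v : V} (hu : u ≠ w)
    (hv : v ≠ w) : (del G {w}).Reachable u v :=
  reachable_map_of_adj (H := G.induce ({w}ᶜ : Set V)) (H' := del G {w}) (fun z => (z : V))
    (fun x y hxy => Adj.reachable ⟨hxy, x.2, y.2⟩)
    ((h2.2 {w} (Set.finite_singleton w) (by simp)).preconnected ⟨u, hu⟩ ⟨v, hv⟩)

/-- The vertex `w` of `Y` lies in a set `K ⊆ Y`, the vertex set of a component of `G - F`, which
together with some cycle of `F` other than `C₀` induces a 2-connected graph. -/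
def GoodIn {G : SimpleGraph V} (C₀ F : G.Subgraph) (Y : Set V) (w : V) : Prop :=
  ∃ (C : G.Subgraph) (K : Set V), C ≤ F ∧ IsCycleSub C ∧ C ≠ C₀ ∧ K ⊆ Y ∧ w ∈ K ∧
    Disjoint K F.verts ∧ (∀ k ∈ K, (inside G K).Reachable w k) ∧
    (∀ k ∈ K, ∀ z, G.Adj k z → z ∈ K ∨ z ∈ F.verts) ∧ IsKConn 2 (G.induce (K ∪ C.verts))

lemma GoodIn.mono {G : SimpleGraph V} {C₀ F F' : G.Subgraph} {Y Y' Z : Set V} {w : V}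
    (h : GoodIn C₀ F Y w) (hFF' : F ≤ F') (hF' : F'.verts ⊆ F.verts ∪ Z) (hZY : Disjoint Z Y)
    (hYY' : Y ⊆ Y') : GoodIn C₀ F' Y' w := by
  obtain ⟨C, K, hCF, hC, hne, hKY, hw, hKF, hconn, hcl, h2⟩ := h
  refine ⟨C, K, hCF.trans hFF', hC, hne, hKY.trans hYY', hw, ?_, hconn,
    fun k hk z hkz => (hcl k hk z hkz).imp id fun h => hFF'.1 h, h2⟩
  refine Set.disjoint_left.2 fun k hk hkF' => ?_
  rcases hF' hkF' with h | h
  · exact Set.disjoint_left.1 hKF hk h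
  · exact Set.disjoint_left.1 hZY h (hKY hk)

lemma GoodIn.isKConn_compOf {G : SimpleGraph V} {C₀ F : G.Subgraph} {Y : Set V} {w : V}
    (h : GoodIn C₀ F Y w) : ∃ C : G.Subgraph, C ≤ F ∧ IsCycleSub C ∧ C ≠ C₀ ∧
      IsKConn 2 (G.induce (compOf G F.verts w ∪ C.verts)) := by
  obtain ⟨C, K, hCF, hC, hne, -, hw, hKF, hconn, hcl, h2⟩ := h
  refine ⟨C, hCF, hC, hne, ?_⟩
  have hK : compOf G F.verts w = K := by
    ext v
    constructor
    · exact fun hv => prop_of_reachable (P := (· ∈ K))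
        (fun x y (hxy : (del G F.verts).Adj x y) hx =>
          (hcl x hx y hxy.1).resolve_right hxy.2.2) hv hw
    · exact fun hv => (hconn v hv).mono fun x y (hxy : (inside G K).Adj x y) =>
        ⟨hxy.1, Set.disjoint_left.1 hKF hxy.2.1, Set.disjoint_left.1 hKF hxy.2.2⟩
  rwa [hK]

/-- Every finite cactus containing `C₀` and avoiding `Y` extends into `Y` to a finite cactus
containing `r`, so that all remaining vertices of `Y` are good. -/
def Extendable {G : SimpleGraph V} (C₀ : G.Subgraph) (Y : Set V) (r : V) : Prop :=
  ∀ F : G.Subgraph, FinCactus F → C₀ ≤ F → Disjoint F.verts Y →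
    ∃ F' : G.Subgraph, FinCactus F' ∧ F ≤ F' ∧ F'.verts ⊆ F.verts ∪ Y ∧ r ∈ F'.verts ∧
      Attachable F' r ∧ (∀ v ∈ F.verts, Attachable F v → Attachable F' v) ∧
      ∀ w ∈ Y, w ∉ F'.verts → GoodIn C₀ F' Y w

lemma exists_extension_of_family {G : SimpleGraph V} {C₀ : G.Subgraph} {𝒦 : Set (Set V)}
    (hfin : 𝒦.Finite) (hdisj : 𝒦.PairwiseDisjoint id) (ρ : Set V → V)
    (hext : ∀ K ∈ 𝒦, Extendable C₀ K (ρ K)) {F : G.Subgraph} (hF : FinCactus F) (hC₀ : C₀ ≤ F)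
    (hFK : ∀ K ∈ 𝒦, Disjoint F.verts K) :
    ∃ F' : G.Subgraph, FinCactus F' ∧ F ≤ F' ∧ F'.verts ⊆ F.verts ∪ ⋃₀ 𝒦 ∧
      (∀ v ∈ F.verts, Attachable F v → Attachable F' v) ∧
      ∀ K ∈ 𝒦, ρ K ∈ F'.verts ∧ Attachable F' (ρ K) ∧
        ∀ w ∈ K, w ∉ F'.verts → GoodIn C₀ F' K w := by
  induction 𝒦, hfin using Set.Finite.induction_on with
  | empty => exact ⟨F, hF, le_rfl, fun v hv => Or.inl hv, fun _ _ h => h, by simp⟩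
  | @insert K 𝒦 hK _ ih =>
    obtain ⟨F₁, hF₁, hFF₁, hverts₁, hatt₁, h𝒦₁⟩ :=
      ih (hdisj.subset (Set.subset_insert _ _)) (fun K' h => hext K' (Or.inr h))
        (fun K' h => hFK K' (Or.inr h))
    have hKK' : ∀ K' ∈ 𝒦, Disjoint K' K := fun K' h =>
      hdisj (Or.inr h) (Or.inl rfl) fun h' => hK (h' ▸ h)
    have hF₁K : Disjoint F₁.verts K := by
      refine Set.disjoint_left.2 fun v hv hvK => ?_
      rcases hverts₁ hv with h | ⟨K', hK', h⟩
      · exact Set.disjoint_left.1 (hFK K (Or.inl rfl)) h hvK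
      · exact Set.disjoint_left.1 (hKK' K' hK') h hvK
    obtain ⟨F₂, hF₂, hF₁₂, hverts₂, hρ, hattρ, hatt₂, hgood⟩ :=
      hext K (Or.inl rfl) F₁ hF₁ (hC₀.trans hFF₁) hF₁K
    refine ⟨F₂, hF₂, hFF₁.trans hF₁₂, fun v hv => ?_,
      fun v hv h => hatt₂ v (hFF₁.1 hv) (hatt₁ v hv h), ?_⟩
    · rw [Set.sUnion_insert]
      rcases hverts₂ hv with h | h
      · exact (hverts₁ h).imp id Or.inr
      · exact Or.inr (Or.inl h)
    · rintro K' (rfl | hK')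
      · exact ⟨hρ, hattρ, hgood⟩
      · obtain ⟨h₁, h₂, h₃⟩ := h𝒦₁ K' hK'
        exact ⟨hF₁₂.1 h₁, hatt₂ _ h₁ h₂, fun w hw hwF => (h₃ w hw fun h => hwF (hF₁₂.1 h)).mono
          hF₁₂ hverts₂ (hKK' K' hK').symm subset_rfl⟩

/-- `G[Y]` is connected and disjoint from `C₀`, and every edge leaving `Y` goes to `C₀`, except
possibly the edge `rp`. -/
structure IsRegion {G : SimpleGraph V} (C₀ : G.Subgraph) (Y : Set V) (r p : V) : Prop where
  root_mem : r ∈ Y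
  port_notMem : p ∉ Y
  disjoint : Disjoint C₀.verts Y
  connected : ∀ y ∈ Y, (inside G Y).Reachable r y
  closed : ∀ y ∈ Y, ∀ z ∉ Y, G.Adj y z → z ∈ C₀.verts ∨ (y = r ∧ z = p)

lemma IsRegion.exists_adj_cycle {G : SimpleGraph V} (h2 : IsKConn 2 G) {C₀ : G.Subgraph}
    (hC₀ : IsCycleSub C₀) {Y : Set V} {r p : V} (hY : IsRegion C₀ Y r p) :
    ∃ t ∈ Y, ∃ c ∈ C₀.verts, G.Adj t c := by
  obtain ⟨a, ha, b, hb, -, -, hab, -⟩ := hC₀.exists_three_verts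
  obtain ⟨c, hc, hcp⟩ : ∃ c ∈ C₀.verts, c ≠ p := by
    by_cases h : a = p
    · exact ⟨b, hb, fun h' => hab (h.trans h'.symm)⟩
    · exact ⟨a, ha, h⟩
  have hrp : r ≠ p := fun h => hY.port_notMem (h ▸ hY.root_mem)
  have := prop_of_reachable
    (P := fun v => (∃ t ∈ Y, ∃ c ∈ C₀.verts, G.Adj t c) ∨ v ∈ Y)
    (fun x y hxy hx => by
      rcases hx with hx | hx
      · exact Or.inl hx
      · by_cases hy : y ∈ Y
        · exact Or.inr hy
        · rcases hY.closed x hx y hy hxy.1 with h | h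
          · exact Or.inl ⟨x, hx, y, h, hxy.1⟩
          · exact absurd h.2 hxy.2.2)
    (h2.reachable_del hrp hcp) (Or.inr hY.root_mem)
  exact this.resolve_right (Set.disjoint_left.1 hY.disjoint hc)

lemma IsRegion.component {G : SimpleGraph V} {C₀ : G.Subgraph} {Y : Set V} {r p : V}
    (hY : IsRegion C₀ Y r p) {z k b : V} (hz : z ∈ Y \ edgeCore G Y r)
    (hk : k ∈ compIn G (Y \ edgeCore G Y r) z) (hb : b ∈ edgeCore G Y r) (hkb : G.Adj k b) :
    IsRegion C₀ (compIn G (Y \ edgeCore G Y r) z) k b where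
  root_mem := hk
  port_notMem h := (compIn_subset hz h).2 hb
  disjoint := hY.disjoint.mono_right fun _ h => (compIn_subset hz h).1
  connected _ hy := reachable_inside_compIn hk hy
  closed y hy x hx hyx := by
    have hyZ := compIn_subset hz hy
    by_cases hxY : x ∈ Y
    · have hxB : x ∈ edgeCore G Y r := by
        by_contra h
        exact hx (mem_compIn_of_adj hz hy ⟨hxY, h⟩ hyx)
      rw [← compIn_eq_of_mem hk] at hy
      obtain ⟨h₁, h₂⟩ := edgeCore_exit_unique hY.root_mem (compIn_subset hz hk) hy hb hxB hkb hyx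
      exact Or.inr ⟨h₁.symm, h₂.symm⟩
    · refine (hY.closed y hyZ.1 x hxY hyx).imp id fun h => ?_
      exact absurd (h.1 ▸ self_mem_edgeCore G Y r) hyZ.2

/-- If all edges of `G[Y]` leaving `K` start at `ρ`, a walk in `G[Y]` from outside `K` to a vertex
of `K` contains a shorter walk in `G[K]` starting at `ρ`. -/
lemma exists_shorter_walk_inside {G : SimpleGraph V} {Y K : Set V} {ρ : V}
    (hexit : ∀ k ∈ K, ∀ y ∈ Y, y ∉ K → G.Adj k y → k = ρ) {a t : V}
    (q : (inside G Y).Walk a t) (ht : t ∈ K) (ha : a ∉ K) :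
    ∃ s : (inside G K).Walk ρ t, s.length + 1 ≤ q.length := by
  have key : (a ∈ K ∧ ∃ s : (inside G K).Walk a t, s.length ≤ q.length) ∨
      ∃ s : (inside G K).Walk ρ t, s.length + 1 ≤ q.length := by
    clear ha
    induction q with
    | nil => exact Or.inl ⟨ht, Walk.nil, le_rfl⟩
    | @cons a b t hab q ih =>
      rw [Walk.length_cons]
      rcases ih ht with ⟨hb, s, hs⟩ | ⟨s, hs⟩
      · by_cases ha : a ∈ K
        · have hab' : (inside G K).Adj a b := ⟨hab.1, ha, hb⟩
          exact Or.inl ⟨ha, Walk.cons hab' s, by rw [Walk.length_cons]; omega⟩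
        · obtain rfl := hexit b hb a hab.2.1 ha hab.1.symm
          exact Or.inr ⟨s, by omega⟩
      · exact Or.inr ⟨s, by omega⟩
  exact key.resolve_left fun h => ha h.1

lemma Subcubic.finite_adj_cycle {G : SimpleGraph V} (hsc : Subcubic G) {C₀ : G.Subgraph}
    (hC₀ : IsCycleSub C₀) : {t | ∃ c ∈ C₀.verts, G.Adj t c}.Finite := by
  refine (hC₀.1.biUnion fun c _ => (hsc c).1).subset ?_
  rintro t ⟨c, hc, htc⟩
  exact Set.mem_biUnion hc htc.symm

/-- A region can be added to every finite cactus avoiding it. -/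
lemma IsRegion.extendable {G : SimpleGraph V} (h2 : IsKConn 2 G) (hsc : Subcubic G)
    {C₀ : G.Subgraph} (hC₀ : IsCycleSub C₀) (n : ℕ) :
    ∀ {Y : Set V} {r p : V}, IsRegion C₀ Y r p →
      (∀ t ∈ Y, (∃ c ∈ C₀.verts, G.Adj t c) → ∃ q : (inside G Y).Walk r t, q.length ≤ n) →
      Extendable C₀ Y r := by
  induction n using Nat.strong_induction_on with
  | _ n ih =>
  intro Y r p hY hlen F hF hCF hFY
  set B := edgeCore G Y r
  have hBY : B ⊆ Y := edgeCore_subset hY.root_mem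
  have hrB : r ∈ B := self_mem_edgeCore G Y r
  have hexit : ∀ K ∈ compIn G (Y \ B) '' (Y \ B), ∃ k ∈ K, ∃ b ∈ B, G.Adj k b := by
    rintro _ ⟨z, hz, rfl⟩
    exact exists_exit_edgeCore hY.connected hz
  have : Nonempty V := ⟨r⟩
  choose! ρ hρ β hβ hρβ using hexit
  have hreg : ∀ z ∈ Y \ B, IsRegion C₀ (compIn G (Y \ B) z)
      (ρ (compIn G (Y \ B) z)) (β (compIn G (Y \ B) z)) := fun z hz =>
    have hK := Set.mem_image_of_mem (compIn G (Y \ B)) hz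
    hY.component hz (hρ _ hK) (hβ _ hK) (hρβ _ hK)
  have hfin : (compIn G (Y \ B) '' (Y \ B)).Finite :=
    finite_compIn_image (hsc.finite_adj_cycle hC₀) fun z hz => (hreg z hz).exists_adj_cycle h2 hC₀
  have hext : ∀ K ∈ compIn G (Y \ B) '' (Y \ B), Extendable C₀ K (ρ K) := by
    rintro _ ⟨z, hz, rfl⟩
    have hshort : ∀ t ∈ compIn G (Y \ B) z, (∃ c ∈ C₀.verts, G.Adj t c) →
        ∃ s : (inside G (compIn G (Y \ B) z)).Walk (ρ (compIn G (Y \ B) z)) t,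
          s.length + 1 ≤ n := by
      intro t ht htc
      obtain ⟨q, hq⟩ := hlen t (compIn_subset hz ht).1 htc
      obtain ⟨s, hs⟩ := exists_shorter_walk_inside (fun k hk y hy hyK hky => by
        rcases (hreg z hz).closed k hk y hyK hky with h | h
        · exact absurd hy (Set.disjoint_left.1 hY.disjoint h)
        · exact h.1) q ht fun h => (compIn_subset hz h).2 hrB
      exact ⟨s, hs.trans hq⟩
    obtain ⟨t, ht, htc⟩ := (hreg z hz).exists_adj_cycle h2 hC₀
    obtain ⟨s, hs⟩ := hshort t ht htc
    refine ih (n - 1) (by omega) (hreg z hz) fun t ht htc => ?_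
    obtain ⟨s, hs⟩ := hshort t ht htc
    exact ⟨s, by omega⟩
  obtain ⟨F₁, hF₁, hFF₁, hverts₁, hatt₁, h𝒦⟩ := exists_extension_of_family hfin
    (pairwiseDisjoint_compIn G (Y \ B)) ρ hext hF hCF (by
      rintro _ ⟨z, hz, rfl⟩
      exact hFY.mono_right fun _ h => (compIn_subset hz h).1)
  have hverts₁' : F₁.verts ⊆ F.verts ∪ Y \ B := fun v hv => (hverts₁ hv).imp id (by
    rintro ⟨_, ⟨z, hz, rfl⟩, h⟩
    exact compIn_subset hz h)
  have hF₁B : Disjoint F₁.verts B := Set.disjoint_left.2 fun v hv hvB =>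
    (hverts₁' hv).elim (fun h => Set.disjoint_left.1 hFY h (hBY hvB)) fun h => h.2 hvB
  obtain ⟨u, a, huF, haB, hua, hatt, hu⟩ : ∃ u a, u ∈ F₁.verts ∧ a ∈ B ∧ G.Adj u a ∧
      Attachable F₁ u ∧ (u ∈ F.verts → u ∈ C₀.verts) := by
    obtain ⟨t, ht, c, hc, htc⟩ := hY.exists_adj_cycle h2 hC₀
    by_cases htB : t ∈ B
    · exact ⟨c, t, hFF₁.1 (hCF.1 hc), htB, htc.symm, Or.inl ⟨C₀, hCF.trans hFF₁, hC₀, hc⟩,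
        fun _ => hc⟩
    · have htZ : t ∈ Y \ B := ⟨ht, htB⟩
      have hK := Set.mem_image_of_mem (compIn G (Y \ B)) htZ
      refine ⟨_, _, (h𝒦 _ hK).1, hβ _ hK, hρβ _ hK, (h𝒦 _ hK).2.1, fun h => ?_⟩
      exact absurd (compIn_subset htZ (hρ _ hK)).1 (Set.disjoint_left.1 hFY h)
  have hedge : ∀ e, ∀ u ∈ B, ∀ v ∈ B, ((inside G B).deleteEdges {e}).Reachable u v :=
    fun e u hu v hv => edgeCore_reachable_deleteEdges hY.root_mem hY.connected e hu hv
  obtain ⟨P, hP, hPB, hrP, haP, hPcyc⟩ : ∃ P : G.Subgraph,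
      (IsCycleSub P ∨ P = G.singletonSubgraph a) ∧ P.verts ⊆ B ∧ r ∈ P.verts ∧ a ∈ P.verts ∧
        ((B \ P.verts).Nonempty → IsCycleSub P) := by
    by_cases hBr : B = {r}
    · obtain rfl : a = r := by rwa [hBr] at haB
      refine ⟨G.singletonSubgraph a, Or.inr rfl, by simpa using haB, by simp, by simp, ?_⟩
      rw [hBr]
      rintro ⟨w, hw, hw'⟩
      exact absurd hw hw'
    · obtain ⟨P, hP, hPB, hrP, haP⟩ := exists_isCycleSub_inside hsc hedge hrB haB hBr
      exact ⟨P, Or.inl hP, hPB, hrP, haP, fun _ => hP⟩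
  obtain ⟨F₂, hF₂, hF₁₂, hPF₂, hverts₂, hatt₂, hattP⟩ :=
    hF₁.attach (hF₁B.mono_right hPB) huF hatt haP hua hP
  have hverts₂' : F₂.verts ⊆ F₁.verts ∪ B := hverts₂ ▸ Set.union_subset_union_right _ hPB
  refine ⟨F₂, hF₂, hFF₁.trans hF₁₂, fun v hv => ?_, hPF₂.1 hrP, hattP r hrP, fun v hv h => ?_,
    fun w hw hwF => ?_⟩
  · rcases hverts₂' hv with h | h
    · exact (hverts₁' h).imp id fun h => h.1
    · exact Or.inr (hBY h)
  · refine hatt₂ v (hFF₁.1 hv) (hatt₁ v hv h) ?_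
    rintro rfl
    exact ⟨C₀, hCF.trans hFF₁, hC₀, hu hv⟩
  by_cases hwB : w ∈ B
  · have hwP : w ∈ B \ P.verts := ⟨hwB, fun h => hwF (hPF₂.1 h)⟩
    have hPc := hPcyc ⟨w, hwP⟩
    have hKB := compIn_subset (G := G) hwP
    refine ⟨P, compIn G (B \ P.verts) w, hPF₂, hPc, ?_, fun k hk => hBY (hKB hk).1,
      self_mem_compIn _ _ _, ?_, fun k hk => reachable_inside_compIn (self_mem_compIn _ _ _) hk,
      fun k hk z hkz => ?_, ?_⟩
    · rintro rfl
      exact Set.disjoint_left.1 hY.disjoint hrP hY.root_mem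
    · refine Set.disjoint_left.2 fun k hk hkF => ?_
      rw [hverts₂] at hkF
      exact hkF.elim (fun h => Set.disjoint_left.1 hF₁B h (hKB hk).1) (hKB hk).2
    · by_cases hzY : z ∈ Y
      · by_cases hzB : z ∈ B
        · by_cases hzP : z ∈ P.verts
          · exact Or.inr (hPF₂.1 hzP)
          · exact Or.inl (mem_compIn_of_adj hwP hk ⟨hzB, hzP⟩ hkz)
        · have hz : z ∈ Y \ B := ⟨hzY, hzB⟩
          have hK := Set.mem_image_of_mem (compIn G (Y \ B)) hz
          have hzρ := (edgeCore_exit_unique hY.root_mem hz (hρ _ hK) (hKB hk).1 (hβ _ hK)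
            hkz.symm (hρβ _ hK)).1
          exact Or.inr (hF₁₂.1 (hzρ ▸ (h𝒦 _ hK).1))
      · rcases hY.closed k (hBY (hKB hk).1) z hzY hkz with h | h
        · exact Or.inr (hF₁₂.1 (hFF₁.1 (hCF.1 h)))
        · exact absurd (h.1 ▸ hrP) (hKB hk).2
    · exact isKConn_two_compIn_union (fun q hq u hu v hv huq hvq =>
        reachable_del_of_reachable_deleteEdges (subcubic_inside hsc B) hedge hq hu hv huq hvq)
        hPc hPB hwP
  · have hwZ : w ∈ Y \ B := ⟨hw, hwB⟩
    have hK := Set.mem_image_of_mem (compIn G (Y \ B)) hwZ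
    exact ((h𝒦 _ hK).2.2 w (self_mem_compIn _ _ _) fun h => hwF (hF₁₂.1 h)).mono hF₁₂ hverts₂'
      (Set.disjoint_left.2 fun v hv h => (compIn_subset hwZ h).2 hv)
      fun v h => (compIn_subset hwZ h).1

/-- If `G` is a 2-connected subcubic graph, `C₀` a cycle of `G` and
`x ∈ V(G)`, then `G` has a finite cactus `F` containing `C₀` and `x` such that for every
component `H` of `G − F` there is a cycle `C ≠ C₀` of `F` with `G[V(H) ∪ V(C)]`
2-connected. -/
theorem cycle_cactus_extension {V : Type u} (G : SimpleGraph V)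
    (h2 : IsKConn 2 G) (hsc : Subcubic G)
    (C₀ : G.Subgraph) (hC₀ : IsCycleSub C₀) (x : V) :
    ∃ F : G.Subgraph, F.verts.Finite ∧ C₀ ≤ F ∧ x ∈ F.verts ∧ IsCactus F.coe ∧
      ∀ w, w ∉ F.verts →
        ∃ C : G.Subgraph, C ≤ F ∧ IsCycleSub C ∧ C ≠ C₀ ∧
          IsKConn 2 (G.induce (compOf G F.verts w ∪ C.verts)) := by
  obtain ⟨p, hp⟩ := hC₀.2.1
  have hchoose : ∀ K ∈ compIn G C₀.vertsᶜ '' C₀.vertsᶜ, ∃ k ∈ K, x ∈ K → k = x := by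
    rintro _ ⟨z, -, rfl⟩
    by_cases hx : x ∈ compIn G C₀.vertsᶜ z
    · exact ⟨x, hx, fun _ => rfl⟩
    · exact ⟨z, self_mem_compIn _ _ _, fun h => absurd h hx⟩
  have : Nonempty V := ⟨x⟩
  choose! ρ hρ hρx using hchoose
  have hreg : ∀ z ∈ C₀.vertsᶜ,
      IsRegion C₀ (compIn G C₀.vertsᶜ z) (ρ (compIn G C₀.vertsᶜ z)) p := fun z hz =>
    have hK := Set.mem_image_of_mem (compIn G C₀.vertsᶜ) hz
    { root_mem := hρ _ hK
      port_notMem := fun h => compIn_subset hz h hp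
      disjoint := Set.disjoint_left.2 fun v hv h => compIn_subset hz h hv
      connected := fun y hy => reachable_inside_compIn (hρ _ hK) hy
      closed := fun y hy v hv hyv => Or.inl <| by
        by_contra h
        exact hv (mem_compIn_of_adj hz hy h hyv) }
  have hA := hsc.finite_adj_cycle hC₀
  have hfin : (compIn G C₀.vertsᶜ '' C₀.vertsᶜ).Finite :=
    finite_compIn_image hA fun z hz => (hreg z hz).exists_adj_cycle h2 hC₀
  have hext : ∀ K ∈ compIn G C₀.vertsᶜ '' C₀.vertsᶜ, Extendable C₀ K (ρ K) := by
    rintro K hK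
    obtain ⟨z, hz, rfl⟩ := id hK
    obtain ⟨n, hn⟩ := (hA.image ((inside G (compIn G C₀.vertsᶜ z)).dist
      (ρ (compIn G C₀.vertsᶜ z)))).bddAbove
    refine (hreg z hz).extendable h2 hsc hC₀ n fun t ht htc => ?_
    obtain ⟨q, hq⟩ := ((hreg z hz).connected t ht).exists_walk_length_eq_dist
    exact ⟨q, hq.trans_le (hn (Set.mem_image_of_mem _ htc))⟩
  obtain ⟨F, hF, hCF, -, -, hgood⟩ := exists_extension_of_family hfin
    (pairwiseDisjoint_compIn G C₀.vertsᶜ) ρ hext hC₀.finCactus le_rfl (by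
      rintro _ ⟨z, hz, rfl⟩
      exact (hreg z hz).disjoint)
  refine ⟨F, hF.finite, hCF, ?_, hF.isCactus hsc, fun w hw => ?_⟩
  · by_cases hx : x ∈ C₀.verts
    · exact hCF.1 hx
    · have hK := Set.mem_image_of_mem (compIn G C₀.vertsᶜ) (show x ∈ C₀.vertsᶜ from hx)
      rw [← hρx _ hK (self_mem_compIn _ _ _)]
      exact (hgood _ hK).1
  · have hwZ : w ∈ C₀.vertsᶜ := fun h => hw (hCF.1 h)
    exact ((hgood _ (Set.mem_image_of_mem _ hwZ)).2.2 w (self_mem_compIn _ _ _) hw).isKConn_compOf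

end IGraph
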